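/- There is no quadruple (a,b,c,d) of Gaussian integers satisfying simultaneously: (R0) each of a, b, c, d is congruent to 1 modulo 1+i; (R1) a·d − b·c is congruent modulo (1+i)³ to u·(1+i) for some unit u ∈ {1, −1, i, −i}; and (R2) the three congruences a² + b² ≡ c² + d², a² + c² ≡ b² + d², and a² + d² ≡ b² + c² all hold modulo (1+i)³. -/

import Mathlib

open Complex

noncomputable section

/-- `z ∈ ℤ[i] ⊆ ℂ`. -/
def IsGauss (z : ℂ) : Prop := ∃ a b : ℤ, z = (a : ℂ) + (b : ℂ) * Complex.I

/-- Divisibility in `ℤ[i]`. -/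
def GDvd (m z : ℂ) : Prop := ∃ k : ℂ, IsGauss k ∧ z = m * k

/-- Congruence modulo `m` in `ℤ[i]`. -/
def GCong (m z w : ℂ) : Prop := GDvd m (z - w)

/-- A Gaussian integer congruent to `1` modulo `1 + i` has coordinates of odd sum. -/
lemma exists_coords_of_gCong_one {z : ℂ} (hz : IsGauss z) (h : GCong (1 + Complex.I) z 1) :
    ∃ y m : ℤ, z = ((2 * m + 1 - y : ℤ) : ℂ) + (y : ℂ) * Complex.I := by
  obtain ⟨x, y, rfl⟩ := hz
  obtain ⟨_, ⟨p, q, rfl⟩, h⟩ := h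
  have hre : x - 1 = p - q := by
    have := congrArg Complex.re h
    simp at this
    exact_mod_cast this
  have him : y = q + p := by
    have := congrArg Complex.im h
    simp at this
    exact_mod_cast this
  refine ⟨y, p, ?_⟩
  rw [show x = 2 * p + 1 - y by omega]

/-- A Gaussian integer divisible by `(1 + i) ^ 3` has even imaginary part, and the sum of its
coordinates is divisible by `4`. -/
lemma coords_of_gDvd_cube {x y : ℤ}
    (h : GDvd ((1 + Complex.I) ^ 3) ((x : ℂ) + (y : ℂ) * Complex.I)) :
    2 ∣ y ∧ 4 ∣ x + y := by
  obtain ⟨_, ⟨p, q, rfl⟩, h⟩ := h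
  have hcube : (1 + Complex.I) ^ 3 = -2 + 2 * Complex.I := by
    linear_combination (3 + Complex.I) * Complex.I_sq
  rw [hcube] at h
  have hre : x = -(2 * p) - 2 * q := by
    have := congrArg Complex.re h
    simp at this
    rify
    linarith
  have him : y = -(2 * q) + 2 * p := by
    have := congrArg Complex.im h
    simp at this
    rify
    linarith
  omega

/-- A unit times `1 + i` has odd imaginary part. -/
lemma exists_coords_unit_mul {u : ℂ} (hu : u ∈ ({1, -1, Complex.I, -Complex.I} : Set ℂ)) :
    ∃ s t : ℤ, u * (1 + Complex.I) = (s : ℂ) + ((2 * t + 1 : ℤ) : ℂ) * Complex.I := by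
  rcases hu with rfl | rfl | rfl | rfl
  · exact ⟨1, 0, by push_cast; ring⟩
  · exact ⟨-1, -1, by push_cast; ring⟩
  · exact ⟨-1, 0, by push_cast; linear_combination Complex.I_sq⟩
  · exact ⟨1, -1, by push_cast; linear_combination -Complex.I_sq⟩

/-- No quadruple of Gaussian integers satisfies simultaneously the conditions
R0(3), R1(3) and R2(3): all entries `≡ 1 (mod 1+i)`; `a·d − b·c ≡ u·(1+i) (mod (1+i)³)`
for some unit `u`; and `a² + b² ≡ c² + d²`, `a² + c² ≡ b² + d²`, `a² + d² ≡ b² + c²`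
modulo `(1+i)³`. -/
theorem stmt8 :
    ¬ ∃ a b c d : ℂ, IsGauss a ∧ IsGauss b ∧ IsGauss c ∧ IsGauss d ∧
      (GCong (1 + Complex.I) a 1 ∧ GCong (1 + Complex.I) b 1 ∧
       GCong (1 + Complex.I) c 1 ∧ GCong (1 + Complex.I) d 1) ∧
      (∃ u : ℂ, u ∈ ({1, -1, Complex.I, -Complex.I} : Set ℂ) ∧
        GCong ((1 + Complex.I) ^ 3) (a * d - b * c) (u * (1 + Complex.I))) ∧
      (GCong ((1 + Complex.I) ^ 3) (a ^ 2 + b ^ 2) (c ^ 2 + d ^ 2) ∧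
       GCong ((1 + Complex.I) ^ 3) (a ^ 2 + c ^ 2) (b ^ 2 + d ^ 2) ∧
       GCong ((1 + Complex.I) ^ 3) (a ^ 2 + d ^ 2) (b ^ 2 + c ^ 2)) := by
  rintro ⟨a, b, c, d, ha, hb, hc, hd, ⟨ha1, hb1, hc1, hd1⟩, ⟨u, hu, hdet⟩, hsq, -, -⟩
  obtain ⟨a, k, rfl⟩ := exists_coords_of_gCong_one ha ha1
  obtain ⟨b, l, rfl⟩ := exists_coords_of_gCong_one hb hb1
  obtain ⟨c, m, rfl⟩ := exists_coords_of_gCong_one hc hc1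
  obtain ⟨d, n, rfl⟩ := exists_coords_of_gCong_one hd hd1
  obtain ⟨s, t, hst⟩ := exists_coords_unit_mul hu
  have sq_eq (y m : ℤ) : (((2 * m + 1 - y : ℤ) : ℂ) + (y : ℂ) * Complex.I) ^ 2 =
      (((2 * m + 1) * (2 * m + 1 - 2 * y) : ℤ) : ℂ) +
        ((2 * y * (2 * m + 1 - y) : ℤ) : ℂ) * Complex.I := by
    push_cast
    linear_combination (y : ℂ) ^ 2 * Complex.I_sq
  have mul_eq (x y z w : ℤ) : ((x : ℂ) + (y : ℂ) * Complex.I) * ((z : ℂ) + (w : ℂ) * Complex.I) =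
      ((x * z - y * w : ℤ) : ℂ) + ((x * w + y * z : ℤ) : ℂ) * Complex.I := by
    push_cast
    linear_combination (y : ℂ) * w * Complex.I_sq
  have add_eq (x y z w : ℤ) : ((x : ℂ) + (y : ℂ) * Complex.I) + ((z : ℂ) + (w : ℂ) * Complex.I) =
      ((x + z : ℤ) : ℂ) + ((y + w : ℤ) : ℂ) * Complex.I := by
    push_cast
    ring
  have sub_eq (x y z w : ℤ) : ((x : ℂ) + (y : ℂ) * Complex.I) - ((z : ℂ) + (w : ℂ) * Complex.I) =
      ((x - z : ℤ) : ℂ) + ((y - w : ℤ) : ℂ) * Complex.I := by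
    push_cast
    ring
  rw [GCong, hst, mul_eq, mul_eq, sub_eq, sub_eq] at hdet
  rw [GCong, sq_eq, sq_eq, sq_eq, sq_eq, add_eq, add_eq, sub_eq] at hsq
  obtain ⟨r, hr⟩ := (coords_of_gDvd_cube hdet).1
  obtain ⟨q, hq⟩ := (coords_of_gDvd_cube hsq).2
  have sq_sum (y m : ℤ) : ∃ j, (2 * m + 1) * (2 * m + 1 - 2 * y) + 2 * y * (2 * m + 1 - y) =
      4 * j + 1 - 2 * y := by
    obtain ⟨e, he⟩ := Int.even_mul_pred_self y
    exact ⟨m ^ 2 + m - e, by linear_combination -2 * he⟩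
  obtain ⟨ja, hja⟩ := sq_sum a k
  obtain ⟨jb, hjb⟩ := sq_sum b l
  obtain ⟨jc, hjc⟩ := sq_sum c m
  obtain ⟨jd, hjd⟩ := sq_sum d n
  have himag : a + d - b - c + 2 * (k * d + n * a - a * d - l * c - m * b + b * c) =
      2 * r + 2 * t + 1 := by
    linear_combination hr
  generalize k * d + n * a - a * d - l * c - m * b + b * c = v at himag
  have hpar : 4 * (ja + jb - jc - jd) - 2 * (a + b - c - d) = 4 * q := by
    linear_combination hq - hja - hjb + hjc + hjd
  omega
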